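/- arXiv:1011.4704 — 3 statements merged into one kernel-verified Lean document; each statement's English description precedes it below -/
import Mathlib

section
/- With the notation of the finite normal-mode expansion, ∫_{−H}^0 B(u,v,w;u)(z)·U_0(z) dz = (1/√H)·Σ_{m=0}^M (u_m·u^x_m + v_m·u^y_m) − (1/√H)·Σ_{m=1}^M λ_m·w_m·u_m. -/
/-- The eigenvalue `λ_n = nπ/H`. -/
noncomputable def lamC (H : ℝ) (n : ℕ) : ℝ := n * Real.pi / H

/-- The cosine normal-mode eigenfunctions: `U_0(z) = 1/√H`,
`U_n(z) = √(2/H)·cos(λ_n z)` for `n ≥ 1`. -/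
noncomputable def Ue (H : ℝ) (n : ℕ) (z : ℝ) : ℝ :=
  if n = 0 then 1 / Real.sqrt H else Real.sqrt (2 / H) * Real.cos (lamC H n * z)

/-- The sine normal-mode eigenfunctions: `W_n(z) = √(2/H)·sin(λ_n z)`. -/
noncomputable def We (H : ℝ) (n : ℕ) (z : ℝ) : ℝ :=
  Real.sqrt (2 / H) * Real.sin (lamC H n * z)

/-- Finite cosine-mode expansion `Σ_{m=0}^M U_m(z)·c_m`. -/
noncomputable def cosExp (H : ℝ) (M : ℕ) (c : ℕ → ℝ) (z : ℝ) : ℝ :=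
  ∑ m ∈ Finset.range (M + 1), Ue H m z * c m

/-- Finite sine-mode expansion `Σ_{m=1}^M W_m(z)·c_m`. -/
noncomputable def sinExp (H : ℝ) (M : ℕ) (c : ℕ → ℝ) (z : ℝ) : ℝ :=
  ∑ m ∈ Finset.Icc 1 M, We H m z * c m

/-- `z`-derivative of the cosine-mode expansion: `−Σ_{m=1}^M λ_m W_m(z)·c_m`. -/
noncomputable def dzCosExp (H : ℝ) (M : ℕ) (c : ℕ → ℝ) (z : ℝ) : ℝ :=
  -∑ m ∈ Finset.Icc 1 M, lamC H m * We H m z * c m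

/-- `z`-derivative of the sine-mode expansion: `Σ_{m=1}^M λ_m U_m(z)·c_m`. -/
noncomputable def dzSinExp (H : ℝ) (M : ℕ) (c : ℕ → ℝ) (z : ℝ) : ℝ :=
  ∑ m ∈ Finset.Icc 1 M, lamC H m * Ue H m z * c m

theorem int_cos_mode (H : ℝ) (hH : 0 < H) (k : ℤ) :
    ∫ z in (-H)..0, Real.cos (k * Real.pi / H * z) = if k = 0 then H else 0 := by
  split_ifs with h
  · subst h; simp
  · have hk : (k : ℝ) ≠ 0 := by exact_mod_cast h
    have hc : (k : ℝ) * Real.pi / H ≠ 0 :=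
      div_ne_zero (mul_ne_zero hk Real.pi_ne_zero) hH.ne'
    rw [intervalIntegral.integral_comp_mul_left (fun x => Real.cos x) hc, integral_cos]
    have : (k : ℝ) * Real.pi / H * (-H) = -(k * Real.pi) := by field_simp
    rw [this, Real.sin_neg, Real.sin_int_mul_pi]
    simp

theorem continuous_Ue (H : ℝ) (n : ℕ) : Continuous (Ue H n) := by
  unfold Ue
  split_ifs <;> fun_prop

theorem continuous_We (H : ℝ) (n : ℕ) : Continuous (We H n) := by
  unfold We
  fun_prop

theorem int_cos_cos (H : ℝ) (hH : 0 < H) (m n : ℕ) (hn : n ≠ 0) :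
    ∫ z in (-H)..0, Real.cos (lamC H m * z) * Real.cos (lamC H n * z)
      = if m = n then H / 2 else 0 := by
  have e : ∀ z, Real.cos (lamC H m * z) * Real.cos (lamC H n * z)
      = (1 / 2) * (Real.cos (((m - n : ℤ) : ℝ) * Real.pi / H * z)
        + Real.cos (((m + n : ℤ) : ℝ) * Real.pi / H * z)) := by
    intro z
    have h1 : ((m - n : ℤ) : ℝ) * Real.pi / H * z = lamC H m * z - lamC H n * z := by
      unfold lamC; push_cast; ring
    have h2 : ((m + n : ℤ) : ℝ) * Real.pi / H * z = lamC H m * z + lamC H n * z := by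
      unfold lamC; push_cast; ring
    rw [h1, h2, Real.cos_sub, Real.cos_add]; ring
  simp_rw [e]
  rw [intervalIntegral.integral_const_mul, intervalIntegral.integral_add
    (by apply Continuous.intervalIntegrable; fun_prop)
    (by apply Continuous.intervalIntegrable; fun_prop), int_cos_mode H hH, int_cos_mode H hH]
  rw [if_neg (show ¬ ((m : ℤ) + n = 0) by omega)]
  by_cases h : m = n
  · rw [if_pos h, if_pos (by omega)]; ring
  · rw [if_neg h, if_neg (by omega)]; ring

theorem int_sin_sin (H : ℝ) (hH : 0 < H) (m n : ℕ) (hn : n ≠ 0) :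
    ∫ z in (-H)..0, Real.sin (lamC H m * z) * Real.sin (lamC H n * z)
      = if m = n then H / 2 else 0 := by
  have e : ∀ z, Real.sin (lamC H m * z) * Real.sin (lamC H n * z)
      = (1 / 2) * (Real.cos (((m - n : ℤ) : ℝ) * Real.pi / H * z)
        - Real.cos (((m + n : ℤ) : ℝ) * Real.pi / H * z)) := by
    intro z
    have h1 : ((m - n : ℤ) : ℝ) * Real.pi / H * z = lamC H m * z - lamC H n * z := by
      unfold lamC; push_cast; ring
    have h2 : ((m + n : ℤ) : ℝ) * Real.pi / H * z = lamC H m * z + lamC H n * z := by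
      unfold lamC; push_cast; ring
    rw [h1, h2, Real.cos_sub, Real.cos_add]; ring
  simp_rw [e]
  rw [intervalIntegral.integral_const_mul, intervalIntegral.integral_sub
    (by apply Continuous.intervalIntegrable; fun_prop)
    (by apply Continuous.intervalIntegrable; fun_prop), int_cos_mode H hH, int_cos_mode H hH]
  rw [if_neg (show ¬ ((m : ℤ) + n = 0) by omega)]
  by_cases h : m = n
  · rw [if_pos h, if_pos (by omega)]; ring
  · rw [if_neg h, if_neg (by omega)]; ring

theorem int_We_We (H : ℝ) (hH : 0 < H) (m n : ℕ) (hn : n ≠ 0) :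
    ∫ z in (-H)..0, We H m z * We H n z = if m = n then 1 else 0 := by
  have hs : Real.sqrt (2 / H) * Real.sqrt (2 / H) = 2 / H :=
    Real.mul_self_sqrt (by positivity)
  have e : ∀ z, We H m z * We H n z
      = 2 / H * (Real.sin (lamC H m * z) * Real.sin (lamC H n * z)) := by
    intro z; rw [← hs]; unfold We; ring
  simp_rw [e]
  rw [intervalIntegral.integral_const_mul, int_sin_sin H hH m n hn]
  split_ifs
  · field_simp
  · simp

theorem int_Ue_Ue_aux (H : ℝ) (hH : 0 < H) (m n : ℕ) (hn : n ≠ 0) :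
    ∫ z in (-H)..0, Ue H m z * Ue H n z = if m = n then 1 else 0 := by
  by_cases hm : m = 0
  · subst hm
    have e : ∀ z, Ue H 0 z * Ue H n z
        = (1 / Real.sqrt H * Real.sqrt (2 / H)) *
          (Real.cos (lamC H 0 * z) * Real.cos (lamC H n * z)) := by
      intro z; simp [Ue, hn, lamC]; ring
    simp_rw [e]
    rw [intervalIntegral.integral_const_mul, int_cos_cos H hH 0 n hn]
    rw [if_neg (Ne.symm hn), if_neg (Ne.symm hn), mul_zero]
  · have hs : Real.sqrt (2 / H) * Real.sqrt (2 / H) = 2 / H :=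
      Real.mul_self_sqrt (by positivity)
    have e : ∀ z, Ue H m z * Ue H n z
        = 2 / H * (Real.cos (lamC H m * z) * Real.cos (lamC H n * z)) := by
      intro z; rw [← hs]; unfold Ue; rw [if_neg hm, if_neg hn]; ring
    simp_rw [e]
    rw [intervalIntegral.integral_const_mul, int_cos_cos H hH m n hn]
    split_ifs
    · field_simp
    · simp

theorem int_Ue_Ue (H : ℝ) (hH : 0 < H) (m n : ℕ) :
    ∫ z in (-H)..0, Ue H m z * Ue H n z = if m = n then 1 else 0 := by
  by_cases hn : n = 0
  · by_cases hm : m = 0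
    · subst hn; subst hm
      have hs : Real.sqrt H * Real.sqrt H = H := Real.mul_self_sqrt hH.le
      have e : ∀ z, Ue H 0 z * Ue H 0 z = 1 / H := by
        intro z; simp only [Ue, if_true]; rw [div_mul_div_comm, hs, one_mul]
      simp_rw [e]
      simp [hH.ne']
    · simp_rw [mul_comm (Ue H m _)]
      rw [int_Ue_Ue_aux H hH n m hm]
      simp only [eq_comm]
  · exact int_Ue_Ue_aux H hH m n hn

theorem int_expansion (a b : ℝ) (s : Finset ℕ) (f : ℕ → ℝ → ℝ) (hf : ∀ n, Continuous (f n))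
    (ho : ∀ m ∈ s, ∀ n ∈ s, ∫ z in a..b, f m z * f n z = if m = n then 1 else 0)
    (c d : ℕ → ℝ) :
    ∫ z in a..b, (∑ m ∈ s, f m z * c m) * (∑ m ∈ s, f m z * d m) = ∑ m ∈ s, c m * d m := by
  have e : ∀ z, (∑ m ∈ s, f m z * c m) * (∑ m ∈ s, f m z * d m)
      = ∑ m ∈ s, ∑ n ∈ s, (c m * d n) * (f m z * f n z) := by
    intro z
    rw [Finset.sum_mul_sum]
    refine Finset.sum_congr rfl fun m _ => Finset.sum_congr rfl fun n _ => ?_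
    ring
  simp_rw [e]
  rw [intervalIntegral.integral_finsetSum
    (fun m _ => Continuous.intervalIntegrable (by fun_prop) _ _)]
  refine Finset.sum_congr rfl fun m hm => ?_
  rw [intervalIntegral.integral_finsetSum
    (fun m _ => Continuous.intervalIntegrable (by fun_prop) _ _)]
  have : ∀ n ∈ s, ∫ z in a..b, (c m * d n) * (f m z * f n z)
      = if m = n then c m * d n else 0 := by
    intro n hn
    rw [intervalIntegral.integral_const_mul, ho m hm n hn]
    simp
  rw [Finset.sum_congr rfl this, Finset.sum_ite_eq, if_pos hm]

/-- Projection of the nonlinear term `B(u,v,w;u) = u·u_x + v·u_y + w·u_z` onto the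
barotropic mode `U_0`.  Here `uc, vc, ucx, ucy, wc` are the normal-mode coefficients
(at a fixed point) of `u, v, ∂u/∂x, ∂u/∂y, w` respectively. -/
theorem B_u_proj_zero (H : ℝ) (hH : 0 < H) (M : ℕ) (hM : 1 ≤ M)
    (uc vc ucx ucy wc : ℕ → ℝ) :
    (∫ z in (-H)..0,
        (cosExp H M uc z * cosExp H M ucx z + cosExp H M vc z * cosExp H M ucy z +
          sinExp H M wc z * dzCosExp H M uc z) * Ue H 0 z)
      = (1 / Real.sqrt H) * ∑ m ∈ Finset.range (M + 1), (uc m * ucx m + vc m * ucy m)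
        - (1 / Real.sqrt H) * ∑ m ∈ Finset.Icc 1 M, lamC H m * wc m * uc m := by
  have hU := continuous_Ue H
  have hW := continuous_We H
  have hC := fun c d => int_expansion (-H) 0 (Finset.range (M + 1)) (Ue H) hU
    (fun m _ n _ => int_Ue_Ue H hH m n) c d
  have hS := int_expansion (-H) 0 (Finset.Icc 1 M) (We H) hW
    (fun m _ n hn => int_We_We H hH m n (by have := Finset.mem_Icc.mp hn; omega))
    wc (fun m => -(lamC H m * uc m))
  have hd : ∀ z, dzCosExp H M uc z = ∑ m ∈ Finset.Icc 1 M, We H m z * -(lamC H m * uc m) := by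
    intro z
    unfold dzCosExp
    rw [← Finset.sum_neg_distrib]
    exact Finset.sum_congr rfl fun m _ => by ring
  have h0 : ∀ z, Ue H 0 z = 1 / Real.sqrt H := fun z => by simp [Ue]
  simp_rw [hd, h0]
  unfold cosExp sinExp
  rw [intervalIntegral.integral_mul_const,
    intervalIntegral.integral_add (Continuous.intervalIntegrable (by fun_prop) _ _)
      (Continuous.intervalIntegrable (by fun_prop) _ _),
    intervalIntegral.integral_add (Continuous.intervalIntegrable (by fun_prop) _ _)
      (Continuous.intervalIntegrable (by fun_prop) _ _), hC, hC, hS]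
  have h3 : ∑ m ∈ Finset.Icc 1 M, wc m * -(lamC H m * uc m)
      = -∑ m ∈ Finset.Icc 1 M, lamC H m * wc m * uc m := by
    rw [← Finset.sum_neg_distrib]
    exact Finset.sum_congr rfl fun m _ => by ring
  rw [h3, Finset.sum_add_distrib]
  ring
end

section
/- With the notation of the finite normal-mode expansion, for every integer n ≥ 1: ∫_{−H}^0 B(u,v,w;ψ)(z)·W_n(z) dz = (1/√H)·(u_0·ψ^x_n + v_0·ψ^y_n) + (1/√(2H))·[ Σ_{m=1}^{n−1} (u_{n−m}·ψ^x_m + v_{n−m}·ψ^y_m) + Σ_{m≥n+1} (u_{m−n}·ψ^x_m + v_{m−n}·ψ^y_m) − Σ_{m≥1} (u_{m+n}·ψ^x_m + v_{m+n}·ψ^y_m) ] + (1/√(2H))·[ Σ_{m=1}^{n−1} λ_m·w_{n−m}·ψ_m + Σ_{m≥1} λ_m·w_{m+n}·ψ_m − Σ_{m≥n+1} λ_m·w_{m−n}·ψ_m ] (all sums are finite since coefficients with index > M vanish). -/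
lemma cosInt (H : ℝ) (hH : 0 < H) (j : ℤ) :
    ∫ z in (-H)..0, Real.cos ((j * Real.pi / H) * z) = if j = 0 then H else 0 := by
  split_ifs with h
  · simp [h]
  · have hj : (j : ℝ) * Real.pi / H ≠ 0 := by
      have : (j : ℝ) ≠ 0 := by exact_mod_cast h
      have := Real.pi_ne_zero
      positivity
    rw [intervalIntegral.integral_comp_mul_left (fun x => Real.cos x) hj, integral_cos]
    have : (j : ℝ) * Real.pi / H * (-H) = -(j * Real.pi) := by field_simp
    rw [this, Real.sin_neg, Real.sin_int_mul_pi]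
    simp

lemma prodTrig (a b c : ℝ) : Real.cos a * Real.sin b * Real.sin c =
    (Real.cos (a + b - c) + Real.cos (a - b + c) - Real.cos (a + b + c) - Real.cos (a - b - c)) / 4 := by
  simp only [Real.cos_add, Real.cos_sub, Real.sin_add, Real.sin_sub]
  ring

lemma tripleInt (H : ℝ) (hH : 0 < H) (k m n : ℕ) :
    ∫ z in (-H)..0, Real.cos (lamC H k * z) * Real.sin (lamC H m * z) * Real.sin (lamC H n * z)
      = ((if (k : ℤ) + m - n = 0 then H else 0) + (if (k : ℤ) - m + n = 0 then H else 0)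
        - (if (k : ℤ) + m + n = 0 then H else 0) - (if (k : ℤ) - m - n = 0 then H else 0)) / 4 := by
  have hi : ∀ j : ℤ, IntervalIntegrable (fun z => Real.cos ((j * Real.pi / H) * z))
      MeasureTheory.volume (-H) 0 := fun j => by
    apply Continuous.intervalIntegrable; fun_prop
  simp only [← cosInt H hH]
  rw [← intervalIntegral.integral_add (hi _) (hi _),
    ← intervalIntegral.integral_sub ((hi _).add (hi _)) (hi _),
    ← intervalIntegral.integral_sub (((hi _).add (hi _)).sub (hi _)) (hi _),
    ← intervalIntegral.integral_div]
  congr 1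
  funext z
  rw [prodTrig]
  simp only [lamC]
  push_cast
  congr 5 <;> ring

lemma modeInt (H : ℝ) (hH : 0 < H) (k m n : ℕ) (hm : 1 ≤ m) (hn : 1 ≤ n) :
    ∫ z in (-H)..0, Ue H k z * We H m z * We H n z
      = (if k = 0 then (1 / Real.sqrt H) * (if m = n then 1 else 0) else 0)
       + (1 / Real.sqrt (2 * H)) * ((if m < n then (if k = n - m then 1 else 0) else 0)
        + (if n + 1 ≤ m then (if k = m - n then 1 else 0) else 0)
        - (if k = m + n then 1 else 0)) := by
  have hs : Real.sqrt (2 / H) * Real.sqrt (2 / H) = 2 / H := Real.mul_self_sqrt (by positivity)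
  have hsH : Real.sqrt H * Real.sqrt H = H := Real.mul_self_sqrt hH.le
  have hH0 : 0 < Real.sqrt H := Real.sqrt_pos.2 hH
  have h2 : Real.sqrt (2 / H) = 2 / Real.sqrt (2 * H) := by
    rw [Real.sqrt_div (by norm_num), Real.sqrt_mul (by norm_num)]
    have : Real.sqrt 2 * Real.sqrt 2 = 2 := Real.mul_self_sqrt (by norm_num)
    have h3 : 0 < Real.sqrt 2 := by positivity
    field_simp
    nlinarith
  have key := tripleInt H hH k m n
  have e : ∀ z, Ue H k z * We H m z * We H n z =
      ((if k = 0 then 1 / Real.sqrt H else Real.sqrt (2 / H)) * (2 / H)) *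
      (Real.cos (lamC H k * z) * Real.sin (lamC H m * z) * Real.sin (lamC H n * z)) := by
    intro z
    unfold Ue We
    generalize Real.sqrt (2 / H) = s at hs
    rw [← hs]
    split_ifs with h
    · simp [h, lamC]; ring
    · ring
  simp only [e]
  rw [intervalIntegral.integral_const_mul, key]
  have i3 : ¬ ((k : ℤ) + m + n = 0) := by omega
  by_cases hk : k = 0
  · subst hk
    by_cases hmn : m = n
    · subst hmn
      have i4 : ¬ (-(m:ℤ) - m = 0) := by omega
      have i5 : ¬ ((m:ℤ) + m = 0) := by omega
      have i6 : ¬ (0 = m + m) := by omega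
      simp [i4, i5, i6]
      field_simp
      norm_num
    · have i1 : ¬ ((m:ℤ) - n = 0) := by omega
      have i2 : ¬ (-(m:ℤ) + n = 0) := by omega
      have i4 : ¬ (-(m:ℤ) - n = 0) := by omega
      have i5 : ¬ ((m:ℤ) + n = 0) := by omega
      have i6 : ¬ (0 = m + n) := by omega
      have i7 : m < n → ¬ (0 = n - m) := by omega
      have i8 : n + 1 ≤ m → ¬ (0 = m - n) := by omega
      have a1 : (if m < n then (if 0 = n - m then (1:ℝ) else 0) else 0) = 0 := by
        split_ifs <;> first | rfl | omega
      have a2 : (if n + 1 ≤ m then (if 0 = m - n then (1:ℝ) else 0) else 0) = 0 := by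
        split_ifs <;> first | rfl | omega
      rw [a1, a2]
      simp [i1, i2, i4, i5, i6, hmn]
  · have a1 : (if m < n then (if k = n - m then (1:ℝ) else 0) else 0)
        = if (k : ℤ) + m - n = 0 then 1 else 0 := by
      split_ifs <;> first | rfl | omega
    have a2 : (if n + 1 ≤ m then (if k = m - n then (1:ℝ) else 0) else 0)
        = if (k : ℤ) - m + n = 0 then 1 else 0 := by
      split_ifs <;> first | rfl | omega
    have a3 : (if k = m + n then (1:ℝ) else 0) = if (k : ℤ) - m - n = 0 then 1 else 0 := by
      split_ifs <;> first | rfl | omega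
    have b : ∀ p : Prop, [Decidable p] → (if p then H else 0) = H * (if p then 1 else 0) := by
      intro p _; split_ifs <;> simp
    rw [a1, a2, a3, if_neg hk, if_neg hk, if_neg i3, h2, b, b ((k : ℤ) - m + n = 0),
      b ((k : ℤ) - m - n = 0)]
    field_simp
    ring

lemma contU (H : ℝ) (k : ℕ) : Continuous (Ue H k) := by
  unfold Ue; split_ifs <;> fun_prop

lemma contW (H : ℝ) (k : ℕ) : Continuous (We H k) := by
  unfold We; fun_prop

lemma projA (H : ℝ) (hH : 0 < H) (M : ℕ) (a b : ℕ → ℝ)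
    (ha : ∀ m, M < m → a m = 0) (hb : ∀ m, M < m → b m = 0) (n : ℕ) (hn : 1 ≤ n) :
    ∫ z in (-H)..0, cosExp H M a z * sinExp H M b z * We H n z
      = (1 / Real.sqrt H) * (a 0 * b n) + (1 / Real.sqrt (2 * H)) *
        ((∑ m ∈ Finset.Ico 1 n, a (n - m) * b m)
          + (∑' m : ℕ, if n + 1 ≤ m then a (m - n) * b m else 0)
          - (∑' m : ℕ, if 1 ≤ m then a (m + n) * b m else 0)) := by
  have e : ∀ z, cosExp H M a z * sinExp H M b z * We H n z =
      ∑ m ∈ Finset.Icc 1 M, ∑ k ∈ Finset.range (M + 1),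
        (a k * b m) * (Ue H k z * We H m z * We H n z) := by
    intro z
    unfold cosExp sinExp
    rw [Finset.sum_mul_sum, Finset.sum_comm, Finset.sum_mul]
    refine Finset.sum_congr rfl fun m _ => ?_
    rw [Finset.sum_mul]
    refine Finset.sum_congr rfl fun k _ => ?_
    ring
  simp only [e]
  have hc : ∀ k m, Continuous fun z => (a k * b m) * (Ue H k z * We H m z * We H n z) := by
    intro k m
    have := contU H k
    have := contW H m
    have := contW H n
    fun_prop
  rw [intervalIntegral.integral_finsetSum fun m _ =>
    (continuous_finsetSum _ fun k _ => hc k m).intervalIntegrable _ _]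
  have inner : ∀ m ∈ Finset.Icc 1 M, ∫ z in (-H)..0, ∑ k ∈ Finset.range (M + 1),
        (a k * b m) * (Ue H k z * We H m z * We H n z) =
      (1 / Real.sqrt H) * (if m = n then a 0 * b m else 0) +
      (1 / Real.sqrt (2 * H)) * ((if m < n then a (n - m) * b m else 0)
        + (if n + 1 ≤ m then a (m - n) * b m else 0) - a (m + n) * b m) := by
    intro m hm
    have hm1 := (Finset.mem_Icc.1 hm).1
    rw [intervalIntegral.integral_finsetSum fun k _ => (hc k m).intervalIntegrable _ _]
    simp only [intervalIntegral.integral_const_mul, modeInt H hH _ m n hm1 hn]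
    have s : ∀ j, ∑ k ∈ Finset.range (M + 1), a k * (if k = j then 1 else 0) = a j := by
      intro j
      simp only [mul_ite, mul_one, mul_zero, Finset.sum_ite_eq', Finset.mem_range]
      split_ifs with h
      · rfl
      · exact (ha j (by omega)).symm
    have t : ∀ k, a k * b m * ((if k = 0 then (1 / Real.sqrt H) * (if m = n then 1 else 0) else 0)
       + (1 / Real.sqrt (2 * H)) * ((if m < n then (if k = n - m then 1 else 0) else 0)
        + (if n + 1 ≤ m then (if k = m - n then 1 else 0) else 0)
        - (if k = m + n then 1 else 0))) =
        (b m * ((1 / Real.sqrt H) * (if m = n then 1 else 0))) * (a k * (if k = 0 then 1 else 0))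
        + (b m * (1 / Real.sqrt (2 * H)) * (if m < n then 1 else 0)) * (a k * (if k = n - m then 1 else 0))
        + (b m * (1 / Real.sqrt (2 * H)) * (if n + 1 ≤ m then 1 else 0)) * (a k * (if k = m - n then 1 else 0))
        - (b m * (1 / Real.sqrt (2 * H))) * (a k * (if k = m + n then 1 else 0)) := by
      intro k
      have r : ∀ (p q : Prop) [Decidable p] [Decidable q], (if p then (if q then (1:ℝ) else 0) else 0)
        = (if p then 1 else 0) * (if q then 1 else 0) := by
        intro p q _ _; split_ifs <;> simp
      have r' : ∀ (p : Prop) (x : ℝ) [Decidable p], (if p then x else 0)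
        = x * (if p then 1 else 0) := by
        intro p x _; split_ifs <;> simp
      rw [r, r, r' (k = 0)]
      ring
    simp only [t]
    rw [Finset.sum_sub_distrib, Finset.sum_add_distrib, Finset.sum_add_distrib,
      ← Finset.mul_sum, ← Finset.mul_sum, ← Finset.mul_sum, ← Finset.mul_sum, s, s, s, s]
    have r' : ∀ (p : Prop) (x : ℝ) [Decidable p], (if p then x else 0)
        = x * (if p then 1 else 0) := by
      intro p x _; split_ifs <;> simp
    rw [r' (m = n) (a 0 * b m), r' (m < n) (a (n - m) * b m), r' (n + 1 ≤ m) (a (m - n) * b m)]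
    ring
  rw [Finset.sum_congr rfl inner, Finset.sum_add_distrib, ← Finset.mul_sum, ← Finset.mul_sum,
    Finset.sum_sub_distrib, Finset.sum_add_distrib]
  congr 1
  · congr 1
    rw [Finset.sum_ite_eq']
    split_ifs with h
    · rfl
    · rw [hb n (by simp at h; omega)]; simp
  · congr 1
    congr 1
    · congr 1
      · rw [← Finset.sum_filter]
        apply Finset.sum_subset
        · intro m; simp; omega
        · intro m h1 h2
          simp at h1 h2
          rw [hb m (by omega)]; simp
      · symm
        apply tsum_eq_sum
        intro m h
        simp only [Finset.mem_Icc, not_and, not_le] at h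
        split_ifs with h'
        · rw [hb m (h (by omega))]; simp
        · rfl
    · symm
      rw [tsum_eq_sum (s := Finset.Icc 1 M)]
      · refine Finset.sum_congr rfl fun m hm => ?_
        rw [if_pos (Finset.mem_Icc.1 hm).1]
      · intro m h
        simp only [Finset.mem_Icc, not_and, not_le] at h
        split_ifs with h'
        · rw [hb m (h h')]; simp
        · rfl

lemma dzSin_eq (H : ℝ) (M : ℕ) (c : ℕ → ℝ) (z : ℝ) :
    dzSinExp H M c z = cosExp H M (fun m => lamC H m * c m) z := by
  unfold dzSinExp cosExp
  rw [Finset.sum_range_eq_add_Ico _ (by omega)]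
  have : Finset.Ico 1 (M + 1) = Finset.Icc 1 M := by ext; simp
  rw [this]
  simp only [lamC, Nat.cast_zero, zero_mul, zero_div, mul_zero, zero_add]
  exact Finset.sum_congr rfl fun m _ => by ring

lemma summ (M : ℕ) (f : ℕ → ℝ) (b : ℕ → ℝ) (hb : ∀ m, M < m → b m = 0)
    (p : ℕ → Prop) [DecidablePred p] : Summable fun m => if p m then f m * b m else 0 := by
  apply summable_of_ne_finset_zero (s := Finset.range (M + 1))
  intro m h
  simp only [Finset.mem_range, not_lt] at h
  rw [hb m (by omega)]; simp

/-- Projection of the nonlinear term `B(u,v,w;ψ) = u·ψ_x + v·ψ_y + w·ψ_z` onto the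
baroclinic mode `W_n`, `n ≥ 1`.  Here `uc, vc, wc, ψc, ψcx, ψcy` are the normal-mode
coefficients (at a fixed point) of `u, v, w, ψ, ∂ψ/∂x, ∂ψ/∂y`, all vanishing above `M`. -/
theorem B_psi_proj_n (H : ℝ) (hH : 0 < H) (M : ℕ) (hM : 1 ≤ M)
    (uc vc wc ψc ψcx ψcy : ℕ → ℝ)
    (huc : ∀ m, M < m → uc m = 0) (hvc : ∀ m, M < m → vc m = 0)
    (hwc : ∀ m, M < m → wc m = 0) (hψc : ∀ m, M < m → ψc m = 0)
    (hψcx : ∀ m, M < m → ψcx m = 0) (hψcy : ∀ m, M < m → ψcy m = 0)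
    (n : ℕ) (hn : 1 ≤ n) :
    (∫ z in (-H)..0,
        (cosExp H M uc z * sinExp H M ψcx z + cosExp H M vc z * sinExp H M ψcy z +
          sinExp H M wc z * dzSinExp H M ψc z) * We H n z)
      = (1 / Real.sqrt H) * (uc 0 * ψcx n + vc 0 * ψcy n)
        + (1 / Real.sqrt (2 * H)) *
          ((∑ m ∈ Finset.Ico 1 n, (uc (n - m) * ψcx m + vc (n - m) * ψcy m))
            + (∑' m : ℕ, if n + 1 ≤ m then uc (m - n) * ψcx m + vc (m - n) * ψcy m else 0)
            - (∑' m : ℕ, if 1 ≤ m then uc (m + n) * ψcx m + vc (m + n) * ψcy m else 0))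
        + (1 / Real.sqrt (2 * H)) *
          ((∑ m ∈ Finset.Ico 1 n, lamC H m * wc (n - m) * ψc m)
            + (∑' m : ℕ, if 1 ≤ m then lamC H m * wc (m + n) * ψc m else 0)
            - (∑' m : ℕ, if n + 1 ≤ m then lamC H m * wc (m - n) * ψc m else 0)) := by
  have hcU : ∀ c, Continuous (cosExp H M c) := fun c => by
    unfold cosExp
    exact continuous_finsetSum _ fun k _ => (contU H k).mul continuous_const
  have hcW : ∀ c, Continuous (sinExp H M c) := fun c => by
    unfold sinExp
    exact continuous_finsetSum _ fun k _ => (contW H k).mul continuous_const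
  have hcn := contW H n
  have hi : ∀ c d, IntervalIntegrable (fun z => cosExp H M c z * sinExp H M d z * We H n z)
      MeasureTheory.volume (-H) 0 := fun c d =>
    (((hcU c).mul (hcW d)).mul hcn).intervalIntegrable _ _
  have e : ∀ z, (cosExp H M uc z * sinExp H M ψcx z + cosExp H M vc z * sinExp H M ψcy z +
          sinExp H M wc z * dzSinExp H M ψc z) * We H n z =
      cosExp H M uc z * sinExp H M ψcx z * We H n z
      + cosExp H M vc z * sinExp H M ψcy z * We H n z
      + cosExp H M (fun m => lamC H m * ψc m) z * sinExp H M wc z * We H n z := by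
    intro z; rw [dzSin_eq]; ring
  simp only [e]
  rw [intervalIntegral.integral_add ((hi _ _).add (hi _ _)) (hi _ _),
    intervalIntegral.integral_add (hi _ _) (hi _ _),
    projA H hH M uc ψcx huc hψcx n hn, projA H hH M vc ψcy hvc hψcy n hn,
    projA H hH M (fun m => lamC H m * ψc m) wc (fun m h => by simp [hψc m h]) hwc n hn]
  have t1 : (∑' m : ℕ, if n + 1 ≤ m then uc (m - n) * ψcx m + vc (m - n) * ψcy m else 0)
      = (∑' m : ℕ, if n + 1 ≤ m then uc (m - n) * ψcx m else 0)
        + (∑' m : ℕ, if n + 1 ≤ m then vc (m - n) * ψcy m else 0) := by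
    rw [← (summ M _ _ hψcx _).tsum_add (summ M _ _ hψcy _)]
    exact tsum_congr fun m => by split_ifs <;> simp
  have t2 : (∑' m : ℕ, if 1 ≤ m then uc (m + n) * ψcx m + vc (m + n) * ψcy m else 0)
      = (∑' m : ℕ, if 1 ≤ m then uc (m + n) * ψcx m else 0)
        + (∑' m : ℕ, if 1 ≤ m then vc (m + n) * ψcy m else 0) := by
    rw [← (summ M _ _ hψcx _).tsum_add (summ M _ _ hψcy _)]
    exact tsum_congr fun m => by split_ifs <;> simp
  have shift : ∀ f : ℕ → ℝ, (∑' m : ℕ, if n + 1 ≤ m then f m else 0)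
      = ∑' m : ℕ, if 1 ≤ m then f (m + n) else 0 := by
    intro f
    rw [← (add_left_injective n).tsum_eq (f := fun m => if n + 1 ≤ m then f m else 0)]
    · refine tsum_congr fun m => ?_
      by_cases h : 1 ≤ m
      · rw [if_pos h, if_pos (by omega)]
      · rw [if_neg h, if_neg (by omega)]
    · intro m h
      have : n + 1 ≤ m := by
        by_contra h'
        simp at h
        omega
      exact ⟨m - n, by simp; omega⟩
  have s1 : (∑' m : ℕ, if n + 1 ≤ m then lamC H (m - n) * ψc (m - n) * wc m else 0)
      = ∑' m : ℕ, if 1 ≤ m then lamC H m * wc (m + n) * ψc m else 0 := by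
    rw [shift]
    refine tsum_congr fun m => ?_
    rw [Nat.add_sub_cancel]
    split_ifs <;> ring
  have s2 : (∑' m : ℕ, if n + 1 ≤ m then lamC H m * wc (m - n) * ψc m else 0)
      = ∑' m : ℕ, if 1 ≤ m then lamC H (m + n) * ψc (m + n) * wc m else 0 := by
    rw [shift]
    refine tsum_congr fun m => ?_
    rw [Nat.add_sub_cancel]
    split_ifs <;> ring
  have s3 : ∑ m ∈ Finset.Ico 1 n, lamC H (n - m) * ψc (n - m) * wc m
      = ∑ m ∈ Finset.Ico 1 n, lamC H m * wc (n - m) * ψc m := by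
    refine Finset.sum_nbij' (fun m => n - m) (fun m => n - m) ?_ ?_ ?_ ?_ ?_
    · intro m; simp; omega
    · intro m; simp; omega
    · intro m; simp; omega
    · intro m; simp; omega
    · intro m hm
      simp only [Finset.mem_Ico] at hm
      have : n - (n - m) = m := by omega
      simp only [this]; ring
  rw [s1, s2, s3, t1, t2, Finset.sum_add_distrib]
  have z0 : lamC H 0 = 0 := by simp [lamC]
  rw [z0]
  ring
end

section
/- Let Ω ⊆ ℝ² be open, T > 0, H > 0, and let Ū₀, f, N be real constants. Fix an integer M ≥ 1 and continuously differentiable functions u_m, v_m, φ_m : Ω × (0, T) → ℝ for 0 ≤ m ≤ M and w_m, ψ_m : Ω × (0, T) → ℝ for 1 ≤ m ≤ M. Define u(x,y,z,t) = Σ_{m=0}^M U_m(z)·u_m(x,y,t), v = Σ_{m=0}^M U_m·v_m, φ = Σ_{m=0}^M U_m·φ_m, w = Σ_{m=1}^M W_m·w_m, ψ = Σ_{m=1}^M W_m·ψ_m. Assume that at every (x,y,t) ∈ Ω × (0,T) and z ∈ (−H, 0) these functions satisfy the primitive equations: u_t + Ū₀u_x + φ_x − fv + (uu_x + vu_y +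 wu_z) = 0, v_t + Ū₀v_x + φ_y + fu + (uv_x + vv_y + wv_z) + fŪ₀ = 0, ψ_t + Ū₀ψ_x + N²w + (uψ_x + vψ_y + wψ_z) = 0, u_x + v_y + w_z = 0, and φ_z = ψ. Then at every (x,y,t) ∈ Ω × (0,T): ∂u_0/∂t + Ū₀·∂u_0/∂x + ∂φ_0/∂x − f·v_0 + ∫_{−H}^0 (uu_x + vu_y + wu_z)·U_0(z) dz = 0, ∂v_0/∂t + Ū₀·∂v_0/∂x + ∂φ_0/∂y + f·u_0 + ∫_{−H}^0 (uv_x + vv_y + wv_z)·U_0(z) dz + fŪ₀√H = 0, and ∂u_0/∂x + ∂v_0/∂y = 0. -/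
/-- Partial derivative in `x` of a function of `(x, y, t)`. -/
noncomputable def px (f : ℝ × ℝ × ℝ → ℝ) (q : ℝ × ℝ × ℝ) : ℝ :=
  deriv (fun x => f (x, q.2.1, q.2.2)) q.1

/-- Partial derivative in `y` of a function of `(x, y, t)`. -/
noncomputable def py (f : ℝ × ℝ × ℝ → ℝ) (q : ℝ × ℝ × ℝ) : ℝ :=
  deriv (fun y => f (q.1, y, q.2.2)) q.2.1

/-- Partial derivative in `t` of a function of `(x, y, t)`. -/
noncomputable def pt (f : ℝ × ℝ × ℝ → ℝ) (q : ℝ × ℝ × ℝ) : ℝ :=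
  deriv (fun t => f (q.1, q.2.1, t)) q.2.2

/-- Partial derivative in `x` of a function of `(x, y, z, t)`. -/
noncomputable def pX (f : ℝ × ℝ × ℝ × ℝ → ℝ) (p : ℝ × ℝ × ℝ × ℝ) : ℝ :=
  deriv (fun x => f (x, p.2.1, p.2.2.1, p.2.2.2)) p.1

/-- Partial derivative in `y` of a function of `(x, y, z, t)`. -/
noncomputable def pY (f : ℝ × ℝ × ℝ × ℝ → ℝ) (p : ℝ × ℝ × ℝ × ℝ) : ℝ :=
  deriv (fun y => f (p.1, y, p.2.2.1, p.2.2.2)) p.2.1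

/-- Partial derivative in `z` of a function of `(x, y, z, t)`. -/
noncomputable def pZ (f : ℝ × ℝ × ℝ × ℝ → ℝ) (p : ℝ × ℝ × ℝ × ℝ) : ℝ :=
  deriv (fun z => f (p.1, p.2.1, z, p.2.2.2)) p.2.2.1

/-- Partial derivative in `t` of a function of `(x, y, z, t)`. -/
noncomputable def pT (f : ℝ × ℝ × ℝ × ℝ → ℝ) (p : ℝ × ℝ × ℝ × ℝ) : ℝ :=
  deriv (fun t => f (p.1, p.2.1, p.2.2.1, t)) p.2.2.2

/-- The finite normal-mode cosine expansion `Σ_{m=0}^M U_m(z)·c_m(x,y,t)`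
as a function of `(x, y, z, t)`. -/
noncomputable def cosExp4 (H : ℝ) (M : ℕ) (c : ℕ → ℝ × ℝ × ℝ → ℝ)
    (p : ℝ × ℝ × ℝ × ℝ) : ℝ :=
  ∑ m ∈ Finset.range (M + 1), Ue H m p.2.2.1 * c m (p.1, p.2.1, p.2.2.2)

/-- The finite normal-mode sine expansion `Σ_{m=1}^M W_m(z)·c_m(x,y,t)`
as a function of `(x, y, z, t)`. -/
noncomputable def sinExp4 (H : ℝ) (M : ℕ) (c : ℕ → ℝ × ℝ × ℝ → ℝ)
    (p : ℝ × ℝ × ℝ × ℝ) : ℝ :=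
  ∑ m ∈ Finset.Icc 1 M, We H m p.2.2.1 * c m (p.1, p.2.1, p.2.2.2)

open MeasureTheory in
lemma ortho (H : ℝ) (hH : 0 < H) (m : ℕ) :
    ∫ z in (-H)..0, Ue H m z * Ue H 0 z = if m = 0 then 1 else 0 := by
  have hs : Real.sqrt H * Real.sqrt H = H := Real.mul_self_sqrt hH.le
  have hs0 : Real.sqrt H ≠ 0 := (Real.sqrt_pos.2 hH).ne'
  rcases Nat.eq_zero_or_pos m with h | h
  · subst h
    simp only [Ue, if_true, intervalIntegral.integral_const, smul_eq_mul]
    rw [div_mul_div_comm, hs]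
    field_simp
    ring
  · have hm : m ≠ 0 := by omega
    have hl : lamC H m ≠ 0 := by
      unfold lamC
      have : (m : ℝ) ≠ 0 := by exact_mod_cast hm
      have := Real.pi_ne_zero
      have := hH.ne'
      positivity
    have hlH : lamC H m * H = m * Real.pi := by
      unfold lamC
      field_simp
    simp only [Ue, if_true, hm, if_false]
    rw [intervalIntegral.integral_mul_const, intervalIntegral.integral_const_mul,
      intervalIntegral.integral_comp_mul_left _ hl, integral_cos]
    simp [hlH, Real.sin_nat_mul_pi]

lemma Ue_cont (H : ℝ) (m : ℕ) : Continuous (Ue H m) := by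
  unfold Ue
  split_ifs <;> fun_prop

lemma key (H : ℝ) (hH : 0 < H) (M : ℕ) (a : ℕ → ℝ) (k : ℝ) (g : ℝ → ℝ)
    (h : ∀ z ∈ Set.Ioo (-H) 0,
      g z + ∑ m ∈ Finset.range (M + 1), Ue H m z * a m + k = 0) :
    (∫ z in (-H)..0, g z * Ue H 0 z) + a 0 + k * Real.sqrt H = 0 := by
  have hs0 : Real.sqrt H ≠ 0 := (Real.sqrt_pos.2 hH).ne'
  have e : ∫ z in (-H)..0, g z * Ue H 0 z
      = ∫ z in (-H)..0, ((∑ m ∈ Finset.range (M + 1), -(a m) * (Ue H m z * Ue H 0 z))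
        + -(k * Real.sqrt H) * (Ue H 0 z * Ue H 0 z)) := by
    rw [intervalIntegral.integral_of_le (by linarith), intervalIntegral.integral_of_le (by linarith),
      MeasureTheory.integral_Ioc_eq_integral_Ioo, MeasureTheory.integral_Ioc_eq_integral_Ioo]
    apply MeasureTheory.setIntegral_congr_fun measurableSet_Ioo
    intro z hz
    have h1 := h z hz
    have h2 : g z = -(∑ m ∈ Finset.range (M + 1), Ue H m z * a m) - k := by linarith
    have h3 : Real.sqrt H * Ue H 0 z = 1 := by
      simp only [Ue, if_true]; field_simp
    have h4 : ∑ m ∈ Finset.range (M + 1), -(a m) * (Ue H m z * Ue H 0 z)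
        = -(∑ m ∈ Finset.range (M + 1), Ue H m z * a m) * Ue H 0 z := by
      rw [neg_mul, Finset.sum_mul, ← Finset.sum_neg_distrib]
      exact Finset.sum_congr rfl fun i _ => by ring
    simp only [h4, h2]
    linear_combination (-k * Ue H 0 z) * (-h3)
  have hi : ∀ (m : ℕ) (c : ℝ), IntervalIntegrable
      (fun z => c * (Ue H m z * Ue H 0 z)) MeasureTheory.volume (-H) 0 := fun m c =>
    (continuous_const.mul ((Ue_cont H m).mul (Ue_cont H 0))).intervalIntegrable _ _
  have hi2 : IntervalIntegrable
      (fun z => ∑ m ∈ Finset.range (M + 1), -(a m) * (Ue H m z * Ue H 0 z))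
      MeasureTheory.volume (-H) 0 :=
    (continuous_finsetSum _ fun m _ =>
      continuous_const.mul ((Ue_cont H m).mul (Ue_cont H 0))).intervalIntegrable _ _
  rw [e, intervalIntegral.integral_add hi2 (hi 0 _),
    intervalIntegral.integral_finsetSum (fun m _ => hi m _)]
  simp only [intervalIntegral.integral_const_mul, ortho H hH]
  simp

lemma pX_cos (H : ℝ) (M : ℕ) (c : ℕ → ℝ × ℝ × ℝ → ℝ) (x y z t : ℝ)
    (h : ∀ m ≤ M, DifferentiableAt ℝ (c m) (x, y, t)) :
    pX (cosExp4 H M c) (x, y, z, t)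
      = ∑ m ∈ Finset.range (M + 1), Ue H m z * px (c m) (x, y, t) := by
  have hd : ∀ m ∈ Finset.range (M + 1),
      DifferentiableAt ℝ (fun s => c m (s, y, t)) x := fun m hm =>
    DifferentiableAt.comp (g := c m) (f := fun s => (s, y, t)) x
      (h m (by simpa [Nat.lt_succ_iff] using hm)) (by fun_prop)
  simp only [pX, px, cosExp4]
  rw [deriv_fun_sum fun m hm => (hd m hm).const_mul _]
  exact Finset.sum_congr rfl fun m hm => deriv_const_mul _ (hd m hm)

lemma pY_cos (H : ℝ) (M : ℕ) (c : ℕ → ℝ × ℝ × ℝ → ℝ) (x y z t : ℝ)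
    (h : ∀ m ≤ M, DifferentiableAt ℝ (c m) (x, y, t)) :
    pY (cosExp4 H M c) (x, y, z, t)
      = ∑ m ∈ Finset.range (M + 1), Ue H m z * py (c m) (x, y, t) := by
  have hd : ∀ m ∈ Finset.range (M + 1),
      DifferentiableAt ℝ (fun s => c m (x, s, t)) y := fun m hm =>
    DifferentiableAt.comp (g := c m) (f := fun s => (x, s, t)) y
      (h m (by simpa [Nat.lt_succ_iff] using hm)) (by fun_prop)
  simp only [pY, py, cosExp4]
  rw [deriv_fun_sum fun m hm => (hd m hm).const_mul _]
  exact Finset.sum_congr rfl fun m hm => deriv_const_mul _ (hd m hm)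

lemma pT_cos (H : ℝ) (M : ℕ) (c : ℕ → ℝ × ℝ × ℝ → ℝ) (x y z t : ℝ)
    (h : ∀ m ≤ M, DifferentiableAt ℝ (c m) (x, y, t)) :
    pT (cosExp4 H M c) (x, y, z, t)
      = ∑ m ∈ Finset.range (M + 1), Ue H m z * pt (c m) (x, y, t) := by
  have hd : ∀ m ∈ Finset.range (M + 1),
      DifferentiableAt ℝ (fun s => c m (x, y, s)) t := fun m hm =>
    DifferentiableAt.comp (g := c m) (f := fun s => (x, y, s)) t
      (h m (by simpa [Nat.lt_succ_iff] using hm)) (by fun_prop)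
  simp only [pT, pt, cosExp4]
  rw [deriv_fun_sum fun m hm => (hd m hm).const_mul _]
  exact Finset.sum_congr rfl fun m hm => deriv_const_mul _ (hd m hm)

lemma We_deriv (H : ℝ) (m : ℕ) (hm : m ≠ 0) (z : ℝ) :
    HasDerivAt (We H m) (lamC H m * Ue H m z) z := by
  have h := ((((hasDerivAt_id z).const_mul (lamC H m)).sin).const_mul (Real.sqrt (2 / H)))
  unfold We
  refine h.congr_deriv ?_
  simp [Ue, hm]
  ring

lemma pZ_sin (H : ℝ) (M : ℕ) (c : ℕ → ℝ × ℝ × ℝ → ℝ) (x y z t : ℝ) :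
    pZ (sinExp4 H M c) (x, y, z, t)
      = ∑ m ∈ Finset.range (M + 1), Ue H m z * (lamC H m * c m (x, y, t)) := by
  have hd : ∀ m ∈ Finset.Icc 1 M,
      HasDerivAt (fun s => We H m s * c m (x, y, t))
        (Ue H m z * (lamC H m * c m (x, y, t))) z := fun m hm => by
    refine ((We_deriv H m (by simp at hm; omega) z).mul_const _).congr_deriv ?_
    ring
  have : pZ (sinExp4 H M c) (x, y, z, t)
      = ∑ m ∈ Finset.Icc 1 M, Ue H m z * (lamC H m * c m (x, y, t)) := by
    simp only [pZ, sinExp4]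
    exact (HasDerivAt.fun_sum hd).deriv
  rw [this]
  apply Finset.sum_subset
  · intro m hm
    simp at hm ⊢
    omega
  · intro m hm hm'
    have : m = 0 := by
      simp at hm hm'
      omega
    subst this
    simp [lamC]

lemma dom_open (Ω : Set (ℝ × ℝ)) (hΩ : IsOpen Ω) (T : ℝ) :
    IsOpen {q : ℝ × ℝ × ℝ | (q.1, q.2.1) ∈ Ω ∧ q.2.2 ∈ Set.Ioo 0 T} :=
  (hΩ.preimage (by fun_prop : Continuous fun q : ℝ × ℝ × ℝ => (q.1, q.2.1))).inter
    (isOpen_Ioo.preimage (by fun_prop : Continuous fun q : ℝ × ℝ × ℝ => q.2.2))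

/-- Projection of the 3D inviscid primitive equations onto the barotropic mode `n = 0`:
if the finite normal-mode expansions `u = Σ U_m u_m`, `v = Σ U_m v_m`, `φ = Σ U_m φ_m`,
`w = Σ W_m w_m`, `ψ = Σ W_m ψ_m` solve the primitive equations on `Ω × (−H,0) × (0,T)`,
then the mode-0 coefficients solve the projected barotropic system. -/
theorem barotropic_mode_projection
    (Ω : Set (ℝ × ℝ)) (hΩ : IsOpen Ω) (T H : ℝ) (hT : 0 < T) (hH : 0 < H)
    (U0 f N : ℝ) (M : ℕ) (hM : 1 ≤ M)
    (um vm pm wm ψm : ℕ → ℝ × ℝ × ℝ → ℝ)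
    (hum : ∀ m ≤ M, ContDiffOn ℝ 1 (um m)
      {q : ℝ × ℝ × ℝ | (q.1, q.2.1) ∈ Ω ∧ q.2.2 ∈ Set.Ioo 0 T})
    (hvm : ∀ m ≤ M, ContDiffOn ℝ 1 (vm m)
      {q : ℝ × ℝ × ℝ | (q.1, q.2.1) ∈ Ω ∧ q.2.2 ∈ Set.Ioo 0 T})
    (hpm : ∀ m ≤ M, ContDiffOn ℝ 1 (pm m)
      {q : ℝ × ℝ × ℝ | (q.1, q.2.1) ∈ Ω ∧ q.2.2 ∈ Set.Ioo 0 T})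
    (hwm : ∀ m, 1 ≤ m → m ≤ M → ContDiffOn ℝ 1 (wm m)
      {q : ℝ × ℝ × ℝ | (q.1, q.2.1) ∈ Ω ∧ q.2.2 ∈ Set.Ioo 0 T})
    (hψm : ∀ m, 1 ≤ m → m ≤ M → ContDiffOn ℝ 1 (ψm m)
      {q : ℝ × ℝ × ℝ | (q.1, q.2.1) ∈ Ω ∧ q.2.2 ∈ Set.Ioo 0 T})
    (heq1 : ∀ p : ℝ × ℝ × ℝ × ℝ, (p.1, p.2.1) ∈ Ω → p.2.2.2 ∈ Set.Ioo 0 T →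
      p.2.2.1 ∈ Set.Ioo (-H) 0 →
      pT (cosExp4 H M um) p + U0 * pX (cosExp4 H M um) p + pX (cosExp4 H M pm) p
        - f * cosExp4 H M vm p
        + (cosExp4 H M um p * pX (cosExp4 H M um) p
            + cosExp4 H M vm p * pY (cosExp4 H M um) p
            + sinExp4 H M wm p * pZ (cosExp4 H M um) p) = 0)
    (heq2 : ∀ p : ℝ × ℝ × ℝ × ℝ, (p.1, p.2.1) ∈ Ω → p.2.2.2 ∈ Set.Ioo 0 T →
      p.2.2.1 ∈ Set.Ioo (-H) 0 →
      pT (cosExp4 H M vm) p + U0 * pX (cosExp4 H M vm) p + pY (cosExp4 H M pm) p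
        + f * cosExp4 H M um p
        + (cosExp4 H M um p * pX (cosExp4 H M vm) p
            + cosExp4 H M vm p * pY (cosExp4 H M vm) p
            + sinExp4 H M wm p * pZ (cosExp4 H M vm) p)
        + f * U0 = 0)
    (heq3 : ∀ p : ℝ × ℝ × ℝ × ℝ, (p.1, p.2.1) ∈ Ω → p.2.2.2 ∈ Set.Ioo 0 T →
      p.2.2.1 ∈ Set.Ioo (-H) 0 →
      pT (sinExp4 H M ψm) p + U0 * pX (sinExp4 H M ψm) p + N ^ 2 * sinExp4 H M wm p
        + (cosExp4 H M um p * pX (sinExp4 H M ψm) p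
            + cosExp4 H M vm p * pY (sinExp4 H M ψm) p
            + sinExp4 H M wm p * pZ (sinExp4 H M ψm) p) = 0)
    (heq4 : ∀ p : ℝ × ℝ × ℝ × ℝ, (p.1, p.2.1) ∈ Ω → p.2.2.2 ∈ Set.Ioo 0 T →
      p.2.2.1 ∈ Set.Ioo (-H) 0 →
      pX (cosExp4 H M um) p + pY (cosExp4 H M vm) p + pZ (sinExp4 H M wm) p = 0)
    (heq5 : ∀ p : ℝ × ℝ × ℝ × ℝ, (p.1, p.2.1) ∈ Ω → p.2.2.2 ∈ Set.Ioo 0 T →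
      p.2.2.1 ∈ Set.Ioo (-H) 0 →
      pZ (cosExp4 H M pm) p = sinExp4 H M ψm p) :
    ∀ q : ℝ × ℝ × ℝ, (q.1, q.2.1) ∈ Ω → q.2.2 ∈ Set.Ioo 0 T →
      (pt (um 0) q + U0 * px (um 0) q + px (pm 0) q - f * vm 0 q
        + (∫ z in (-H)..0,
            (cosExp4 H M um (q.1, q.2.1, z, q.2.2) * pX (cosExp4 H M um) (q.1, q.2.1, z, q.2.2)
              + cosExp4 H M vm (q.1, q.2.1, z, q.2.2) * pY (cosExp4 H M um) (q.1, q.2.1, z, q.2.2)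
              + sinExp4 H M wm (q.1, q.2.1, z, q.2.2) * pZ (cosExp4 H M um) (q.1, q.2.1, z, q.2.2))
            * Ue H 0 z) = 0)
      ∧ (pt (vm 0) q + U0 * px (vm 0) q + py (pm 0) q + f * um 0 q
        + (∫ z in (-H)..0,
            (cosExp4 H M um (q.1, q.2.1, z, q.2.2) * pX (cosExp4 H M vm) (q.1, q.2.1, z, q.2.2)
              + cosExp4 H M vm (q.1, q.2.1, z, q.2.2) * pY (cosExp4 H M vm) (q.1, q.2.1, z, q.2.2)
              + sinExp4 H M wm (q.1, q.2.1, z, q.2.2) * pZ (cosExp4 H M vm) (q.1, q.2.1, z, q.2.2))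
            * Ue H 0 z)
        + f * U0 * Real.sqrt H = 0)
      ∧ px (um 0) q + py (vm 0) q = 0 := by
  rintro ⟨x, y, t⟩ hq ht
  have hn := (dom_open Ω hΩ T).mem_nhds (show (x, y, t) ∈ _ from ⟨hq, ht⟩)
  have du : ∀ m ≤ M, DifferentiableAt ℝ (um m) (x, y, t) := fun m hm =>
    ((hum m hm).contDiffAt hn).differentiableAt one_ne_zero
  have dv : ∀ m ≤ M, DifferentiableAt ℝ (vm m) (x, y, t) := fun m hm =>
    ((hvm m hm).contDiffAt hn).differentiableAt one_ne_zero
  have dp : ∀ m ≤ M, DifferentiableAt ℝ (pm m) (x, y, t) := fun m hm =>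
    ((hpm m hm).contDiffAt hn).differentiableAt one_ne_zero
  refine ⟨?_, ?_, ?_⟩
  · have := key H hH M (fun m => pt (um m) (x, y, t) + U0 * px (um m) (x, y, t)
      + px (pm m) (x, y, t) - f * vm m (x, y, t)) 0
      (fun z => cosExp4 H M um (x, y, z, t) * pX (cosExp4 H M um) (x, y, z, t)
              + cosExp4 H M vm (x, y, z, t) * pY (cosExp4 H M um) (x, y, z, t)
              + sinExp4 H M wm (x, y, z, t) * pZ (cosExp4 H M um) (x, y, z, t)) (by
        intro z hz
        have h := heq1 (x, y, z, t) hq ht hz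
        have e : ∑ m ∈ Finset.range (M + 1), Ue H m z * (pt (um m) (x, y, t)
            + U0 * px (um m) (x, y, t) + px (pm m) (x, y, t) - f * vm m (x, y, t))
            = pT (cosExp4 H M um) (x, y, z, t) + U0 * pX (cosExp4 H M um) (x, y, z, t)
              + pX (cosExp4 H M pm) (x, y, z, t) - f * cosExp4 H M vm (x, y, z, t) := by
          rw [pT_cos H M um x y z t du, pX_cos H M um x y z t du, pX_cos H M pm x y z t dp]
          simp only [cosExp4]
          rw [Finset.mul_sum, Finset.mul_sum, ← Finset.sum_add_distrib,
            ← Finset.sum_add_distrib, ← Finset.sum_sub_distrib]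
          exact Finset.sum_congr rfl fun i _ => by ring
        simp only [e]
        linarith)
    simp only at this ⊢
    linarith
  · have := key H hH M (fun m => pt (vm m) (x, y, t) + U0 * px (vm m) (x, y, t)
      + py (pm m) (x, y, t) + f * um m (x, y, t)) (f * U0)
      (fun z => cosExp4 H M um (x, y, z, t) * pX (cosExp4 H M vm) (x, y, z, t)
              + cosExp4 H M vm (x, y, z, t) * pY (cosExp4 H M vm) (x, y, z, t)
              + sinExp4 H M wm (x, y, z, t) * pZ (cosExp4 H M vm) (x, y, z, t)) (by
        intro z hz
        have h := heq2 (x, y, z, t) hq ht hz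
        have e : ∑ m ∈ Finset.range (M + 1), Ue H m z * (pt (vm m) (x, y, t)
            + U0 * px (vm m) (x, y, t) + py (pm m) (x, y, t) + f * um m (x, y, t))
            = pT (cosExp4 H M vm) (x, y, z, t) + U0 * pX (cosExp4 H M vm) (x, y, z, t)
              + pY (cosExp4 H M pm) (x, y, z, t) + f * cosExp4 H M um (x, y, z, t) := by
          rw [pT_cos H M vm x y z t dv, pX_cos H M vm x y z t dv, pY_cos H M pm x y z t dp]
          simp only [cosExp4]
          rw [Finset.mul_sum, Finset.mul_sum, ← Finset.sum_add_distrib,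
            ← Finset.sum_add_distrib, ← Finset.sum_add_distrib]
          exact Finset.sum_congr rfl fun i _ => by ring
        simp only [e]
        linarith)
    simp only at this ⊢
    linarith
  · have := key H hH M (fun m => px (um m) (x, y, t) + py (vm m) (x, y, t)
      + lamC H m * wm m (x, y, t)) 0 (fun _ => 0) (by
        intro z hz
        have h := heq4 (x, y, z, t) hq ht hz
        rw [pX_cos H M um x y z t du, pY_cos H M vm x y z t dv, pZ_sin,
          ← Finset.sum_add_distrib, ← Finset.sum_add_distrib] at h
        simp only [mul_add]
        linarith)
    simpa [lamC] using this
end
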